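/- For any n-qubit stabilizer state |ψ⟩, the number of stabilizer states orthogonal to |ψ⟩ equals N(n)(2^n − 1)/(3·2^n), where N(n) is the total number of n-qubit stabilizer states; in particular the fraction of orthogonal states tends to 1/3 as n → ∞. -/

import Mathlib

open scoped BigOperators

noncomputable section

/-- The state space of `n` qubits, as complex functions on bitstrings. -/
abbrev QState (n : ℕ) : Type := (Fin n → ZMod 2) → ℂ

/-- Hermitian inner product `⟨ψ|φ⟩` (conjugate-linear in the first argument). -/
def qInner {n : ℕ} (ψ φ : QState n) : ℂ := ∑ b, (starRingEnd ℂ) (ψ b) * φ b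

/-- The Pauli operator `i^k · X(x) Z(z)` on `n` qubits. -/
def pauliFun (n : ℕ) (k : ZMod 4) (x z : Fin n → ZMod 2) : QState n → QState n :=
  fun ψ b => Complex.I ^ k.val * (-1 : ℂ) ^ (∑ i, (z i * (b i + x i)).val) * ψ (b + x)

/-- The `n`-qubit Pauli group, as a set of operators. -/
def PauliGroup (n : ℕ) : Set (QState n → QState n) :=
  {U | ∃ k x z, U = pauliFun n k x z}

/-- The stabilizer group of a state: Pauli operators fixing it. -/
def stabGroup (n : ℕ) (ψ : QState n) : Set (QState n → QState n) :=
  {U | U ∈ PauliGroup n ∧ U ψ = ψ}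

/-- An `n`-qubit stabilizer state: a unit vector with `2^n` stabilizers. -/
def IsStabilizerState (n : ℕ) (ψ : QState n) : Prop :=
  qInner ψ ψ = 1 ∧ (stabGroup n ψ).ncard = 2 ^ n

/-- Two states are parallel (equal up to a global phase/scalar). -/
def Parallel {n : ℕ} (ψ φ : QState n) : Prop := ∃ c : ℂ, φ = c • ψ

/-- The number of stabilizer states, counted up to global phase, satisfying `P`. -/
def stabQuotCard (n : ℕ) (P : QState n → Prop) : ℕ :=
  Nat.card (Quot (fun ψ φ : {ψ : QState n // IsStabilizerState n ψ ∧ P ψ} =>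
    Parallel ψ.1 φ.1))

section SymplecticCounting

set_option linter.unusedSectionVars false

open scoped Classical

variable {V : Type} [AddCommGroup V] [Module (ZMod 2) V] [Fintype V]

lemma zmod2_eq_one {a : ZMod 2} (h : a ≠ 0) : a = 1 := by
  revert a; decide

lemma zmod2_add_self (u : V) : u + u = 0 := by
  have : ((1 : ZMod 2) + 1) • u = u + u := by rw [add_smul, one_smul]
  rw [← this]
  have h : (1 : ZMod 2) + 1 = 0 := by decide
  rw [h, zero_smul]

/-- Exactly half of the elements of `S` pair to `1` with `v`. -/
lemma half_card (B : LinearMap.BilinForm (ZMod 2) V) (S : Submodule (ZMod 2) V) (v : V)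
    (h : ∃ u ∈ S, B u v = 1) :
    2 * (Finset.univ.filter (fun u : V => u ∈ S ∧ B u v = 1)).card =
      2 ^ Module.finrank (ZMod 2) S := by
  obtain ⟨u0, hu0, h0⟩ := h
  have e : (Finset.univ.filter (fun u : V => u ∈ S ∧ B u v = 1)).card =
      (Finset.univ.filter (fun u : V => u ∈ S ∧ ¬ B u v = 1)).card := by
    refine Finset.card_bij (fun u _ => u + u0) ?_ ?_ ?_
    · intro u hu
      simp only [Finset.mem_filter, Finset.mem_univ, true_and] at hu ⊢
      refine ⟨S.add_mem hu.1 hu0, ?_⟩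
      rw [map_add, LinearMap.add_apply, hu.2, h0]; decide
    · intro a _ b _ hab
      exact add_right_cancel hab
    · intro u hu
      simp only [Finset.mem_filter, Finset.mem_univ, true_and] at hu
      refine ⟨u + u0, ?_, ?_⟩
      · simp only [Finset.mem_filter, Finset.mem_univ, true_and]
        refine ⟨S.add_mem hu.1 hu0, ?_⟩
        rw [map_add, LinearMap.add_apply, h0]
        have := hu.2
        generalize B u v = c at this
        revert c; decide
      · rw [add_assoc, zmod2_add_self, add_zero]
  have hc : (2 : ℕ) ^ Module.finrank (ZMod 2) S = Nat.card S := by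
    rw [Module.natCard_eq_pow_finrank (K := ZMod 2) (V := S)]; simp
  have hc2 : Nat.card S = (Finset.univ.filter (fun u : V => u ∈ S)).card := by
    rw [Nat.card_eq_fintype_card, Fintype.card_subtype]
  rw [hc, hc2, ← Finset.card_filter_add_card_filter_not (s := Finset.univ.filter (fun u : V => u ∈ S))
    (fun u => B u v = 1), Finset.filter_filter, Finset.filter_filter, ← e, two_mul]

/-- transvection along `a` -/
def transv (B : LinearMap.BilinForm (ZMod 2) V) (hs : ∀ u v, B u v = B v u)
    (ha : ∀ u, B u u = 0) (a : V) : V ≃ₗ[ZMod 2] V :=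
  LinearEquiv.ofInvolutive (LinearMap.id + (B a).smulRight a) (by
    intro x
    simp only [LinearMap.add_apply, LinearMap.id_apply, LinearMap.smulRight_apply, map_add,
      map_smul, ha, zero_smul, smul_zero, add_zero]
    rw [add_assoc, zmod2_add_self, add_zero])

lemma transv_apply (B : LinearMap.BilinForm (ZMod 2) V) (hs : ∀ u v, B u v = B v u)
    (ha : ∀ u, B u u = 0) (a x : V) : transv B hs ha a x = x + B a x • a := rfl

lemma transv_transv (B : LinearMap.BilinForm (ZMod 2) V) (hs : ∀ u v, B u v = B v u)
    (ha : ∀ u, B u u = 0) (a x : V) : transv B hs ha a (transv B hs ha a x) = x :=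
  (transv B hs ha a).left_inv x

lemma transv_form (B : LinearMap.BilinForm (ZMod 2) V) (hs : ∀ u v, B u v = B v u)
    (ha : ∀ u, B u u = 0) (a x y : V) :
    B (transv B hs ha a x) (transv B hs ha a y) = B x y := by
  simp only [transv_apply, map_add, LinearMap.add_apply, map_smul, LinearMap.smul_apply, ha,
    smul_eq_mul, mul_zero, add_zero]
  rw [hs x a, mul_comm (B a y) (B a x), add_assoc]
  have : ∀ c : ZMod 2, c + c = 0 := by decide
  rw [this, add_zero]

/-- Self-orthogonal (Lagrangian) subspaces. -/
def IsLag (B : LinearMap.BilinForm (ZMod 2) V) (L : Submodule (ZMod 2) V) : Prop :=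
  ∀ v, v ∈ L ↔ ∀ u ∈ L, B u v = 0

/-- image under the transvection -/
def tmap (B : LinearMap.BilinForm (ZMod 2) V) (hs : ∀ u v, B u v = B v u)
    (ha : ∀ u, B u u = 0) (a : V) (L : Submodule (ZMod 2) V) : Submodule (ZMod 2) V :=
  L.comap (transv B hs ha a).toLinearMap

lemma mem_tmap (B : LinearMap.BilinForm (ZMod 2) V) (hs : ∀ u v, B u v = B v u)
    (ha : ∀ u, B u u = 0) (a : V) (L : Submodule (ZMod 2) V) (x : V) :
    x ∈ tmap B hs ha a L ↔ transv B hs ha a x ∈ L := Iff.rfl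

lemma tmap_tmap (B : LinearMap.BilinForm (ZMod 2) V) (hs : ∀ u v, B u v = B v u)
    (ha : ∀ u, B u u = 0) (a : V) (L : Submodule (ZMod 2) V) :
    tmap B hs ha a (tmap B hs ha a L) = L := by
  ext x
  rw [mem_tmap, mem_tmap, transv_transv]

lemma tmap_isLag (B : LinearMap.BilinForm (ZMod 2) V) (hs : ∀ u v, B u v = B v u)
    (ha : ∀ u, B u u = 0) (a : V) (L : Submodule (ZMod 2) V) (hL : IsLag B L) :
    IsLag B (tmap B hs ha a L) := by
  intro v
  rw [mem_tmap, hL]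
  constructor
  · intro h u hu
    rw [← transv_form B hs ha a]
    exact h _ hu
  · intro h u hu
    rw [← transv_transv B hs ha a u, transv_form]
    apply h
    rw [mem_tmap, transv_transv]; exact hu

lemma lag_finrank {n : ℕ} (B : LinearMap.BilinForm (ZMod 2) V)
    (hnd : B.Nondegenerate) (hV : Module.finrank (ZMod 2) V = 2 * n)
    {L : Submodule (ZMod 2) V} (hL : IsLag B L) : Module.finrank (ZMod 2) L = n := by
  have h1 : B.orthogonal L = L := by
    ext v; rw [LinearMap.BilinForm.mem_orthogonal_iff, hL v]
  have := LinearMap.BilinForm.finrank_orthogonal hnd L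
  rw [h1, hV] at this
  have h2 := Submodule.finrank_le L
  omega

lemma lag_half {n : ℕ} (B : LinearMap.BilinForm (ZMod 2) V)
    (hnd : B.Nondegenerate) (hV : Module.finrank (ZMod 2) V = 2 * n)
    {L : Submodule (ZMod 2) V} (hL : IsLag B L) (v : V) (hv : v ∉ L) :
    2 * (Finset.univ.filter (fun u : V => u ∈ L ∧ B u v = 1)).card = 2 ^ n := by
  rw [half_card, lag_finrank B hnd hV hL]
  rw [hL] at hv
  push Not at hv
  obtain ⟨u, hu, h⟩ := hv
  exact ⟨u, hu, zmod2_eq_one h⟩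

lemma perp_half {n : ℕ} (B : LinearMap.BilinForm (ZMod 2) V) (hs : ∀ u v, B u v = B v u)
    (hnd : B.Nondegenerate) (hV : Module.finrank (ZMod 2) V = 2 * n)
    (W : Submodule (ZMod 2) V) (v : V) (hv : v ∉ W) :
    2 * (Finset.univ.filter (fun u : V => u ∈ B.orthogonal W ∧ B u v = 1)).card =
      2 ^ (2 * n - Module.finrank (ZMod 2) W) := by
  rw [half_card, LinearMap.BilinForm.finrank_orthogonal hnd, hV]
  by_contra hcon
  push Not at hcon
  apply hv
  have hr : B.IsRefl := fun x y h => by rw [hs]; exact h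
  rw [← LinearMap.BilinForm.orthogonal_orthogonal hnd hr W,
    LinearMap.BilinForm.mem_orthogonal_iff]
  intro u hu
  by_contra h
  exact hcon u hu (zmod2_eq_one h)

/-- finrank changes by one under the exchange. -/
lemma exchange_finrank (B : LinearMap.BilinForm (ZMod 2) V) (hs : ∀ u v, B u v = B v u)
    (ha : ∀ u, B u u = 0) {M : Submodule (ZMod 2) V} (hM : IsLag B M)
    {L : Submodule (ZMod 2) V} (hL : IsLag B L) {u v : V} (hv : v ∈ M) (hu : u ∈ L)
    (huv : B u v = 1) :
    Module.finrank (ZMod 2) (tmap B hs ha (u + v) L ⊓ M : Submodule (ZMod 2) V) =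
      Module.finrank (ZMod 2) (L ⊓ M : Submodule (ZMod 2) V) + 1 := by
  have hvL : v ∉ L := by
    intro h
    have := (hL v).1 h u hu
    rw [huv] at this
    exact absurd this (by decide)
  have key : (tmap B hs ha (u + v) L ⊓ M) = (L ⊓ M) ⊔ Submodule.span (ZMod 2) {v} := by
    have hle : L ⊓ M ≤ tmap B hs ha (u + v) L ⊓ M := by
      intro x hx
      refine Submodule.mem_inf.2 ⟨?_, hx.2⟩
      rw [mem_tmap, transv_apply, map_add, LinearMap.add_apply, (hL x).1 hx.1 u hu,
        (hM x).1 hx.2 v hv, add_zero, zero_smul, add_zero]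
      exact hx.1
    have hvm : v ∈ tmap B hs ha (u + v) L ⊓ M := by
      refine Submodule.mem_inf.2 ⟨?_, hv⟩
      rw [mem_tmap, transv_apply, map_add, LinearMap.add_apply, ha, huv, add_zero, one_smul,
        add_comm u v, ← add_assoc, zmod2_add_self, zero_add]
      exact hu
    apply le_antisymm
    · intro x hx
      have hx1 := (Submodule.mem_inf.1 hx).1
      rw [mem_tmap, transv_apply, map_add, LinearMap.add_apply, (hM x).1 hx.2 v hv,
        add_zero] at hx1
      by_cases h : B u x = 0
      · rw [h, zero_smul, add_zero] at hx1
        exact Submodule.mem_sup_left ⟨hx1, hx.2⟩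
      · have h1 := zmod2_eq_one h
        rw [h1, one_smul] at hx1
        have h2 : x + v ∈ L := by
          have := L.add_mem hx1 hu
          have e : x + (u + v) + u = x + v + (u + u) := by abel
          rwa [e, zmod2_add_self, add_zero] at this
        have e : x = (x + v) + v := by rw [add_assoc, zmod2_add_self, add_zero]
        rw [e]
        exact Submodule.add_mem_sup ⟨h2, M.add_mem hx.2 hv⟩ (Submodule.mem_span_singleton_self v)
    · exact sup_le hle ((Submodule.span_singleton_le_iff_mem _ _).2 hvm)
  have hd : Disjoint (L ⊓ M) (Submodule.span (ZMod 2) {v}) := by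
    rw [Submodule.disjoint_span_singleton]
    intro h
    exact absurd h.1 hvL
  have hv0 : v ≠ 0 := fun h => hvL (h ▸ L.zero_mem)
  have := Submodule.finrank_sup_add_finrank_inf_eq (L ⊓ M) (Submodule.span (ZMod 2) {v})
  rw [hd.eq_bot, finrank_bot, finrank_span_singleton hv0] at this
  rw [key]; simpa using this

/-- weighted number of Lagrangians containing `W`. -/
def lagSum (B : LinearMap.BilinForm (ZMod 2) V) (M : Submodule (ZMod 2) V) (n r : ℕ)
    (W : Submodule (ZMod 2) V) : ℕ :=
  ∑ᶠ L ∈ {L : Submodule (ZMod 2) V | IsLag B L ∧ W ≤ L},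
    r ^ (n - Module.finrank (ZMod 2) (L ⊓ M : Submodule (ZMod 2) V))

lemma lagSum_eq [Fintype (Submodule (ZMod 2) V)]
    (B : LinearMap.BilinForm (ZMod 2) V) (M : Submodule (ZMod 2) V) (n r : ℕ)
    (W : Submodule (ZMod 2) V) : lagSum B M n r W =
    ∑ L ∈ Finset.univ.filter (fun L => IsLag B L ∧ W ≤ L),
      r ^ (n - Module.finrank (ZMod 2) (L ⊓ M : Submodule (ZMod 2) V)) := by
  rw [lagSum]
  exact finsum_mem_eq_sum_of_inter_support_eq _ (by ext; simp)

lemma lagSum_top {n r : ℕ} (B : LinearMap.BilinForm (ZMod 2) V)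
    (hnd : B.Nondegenerate) (hV : Module.finrank (ZMod 2) V = 2 * n)
    {M : Submodule (ZMod 2) V} (hM : IsLag B M) : lagSum B M n r M = 1 := by
  have : Fintype (Submodule (ZMod 2) V) := Fintype.ofFinite _
  rw [lagSum_eq, Finset.sum_eq_single M]
  · rw [inf_idem, lag_finrank B hnd hV hM]; simp
  · intro L hL hne
    simp only [Finset.mem_filter, Finset.mem_univ, true_and] at hL
    exfalso
    apply hne
    symm
    apply Submodule.eq_of_le_of_finrank_eq hL.2
    rw [lag_finrank B hnd hV hM, lag_finrank B hnd hV hL.1]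
  · intro h
    exfalso
    apply h
    simp [hM]

lemma lagSum_step {n r : ℕ} (B : LinearMap.BilinForm (ZMod 2) V) (hs : ∀ u v, B u v = B v u)
    (ha : ∀ u, B u u = 0)
    (hnd : B.Nondegenerate) (hV : Module.finrank (ZMod 2) V = 2 * n)
    {M : Submodule (ZMod 2) V} (hM : IsLag B M) (W : Submodule (ZMod 2) V) (hW : W ≤ M)
    (v : V) (hv : v ∈ M) (hvW : v ∉ W) :
    lagSum B M n r W = (1 + r * 2 ^ (n - Module.finrank (ZMod 2) W)) *
      lagSum B M n r (W ⊔ Submodule.span (ZMod 2) {v}) := by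
  have : Fintype (Submodule (ZMod 2) V) := Fintype.ofFinite _
  set f : Submodule (ZMod 2) V → ℕ :=
    fun L => r ^ (n - Module.finrank (ZMod 2) (L ⊓ M : Submodule (ZMod 2) V)) with hf
  set S2 : ℕ := ∑ L ∈ Finset.univ.filter (fun L => (IsLag B L ∧ W ≤ L) ∧ ¬ v ∈ L), f L with hS2
  have hsplit : lagSum B M n r W = lagSum B M n r (W ⊔ Submodule.span (ZMod 2) {v}) + S2 := by
    rw [lagSum_eq, lagSum_eq, ← Finset.sum_filter_add_sum_filter_not _ (fun L => v ∈ L),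
      Finset.filter_filter, Finset.filter_filter, hS2]
    congr 1
    apply Finset.sum_congr _ (fun _ _ => rfl)
    ext L
    simp [and_assoc]
  have hrank : Module.finrank (ZMod 2) W ≤ n := by
    rw [← lag_finrank B hnd hV hM]; exact Submodule.finrank_mono hW
  set A := lagSum B M n r (W ⊔ Submodule.span (ZMod 2) {v}) with hA
  have h1 : 2 ^ n * S2 = 2 * ∑ L ∈ Finset.univ.filter (fun L => IsLag B L ∧ W ≤ L),
      ∑ u ∈ Finset.univ.filter (fun u : V => u ∈ L ∧ B u v = 1), f L := by
    rw [hS2, Finset.mul_sum, Finset.mul_sum, ← Finset.filter_filter, Finset.sum_filter]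
    apply Finset.sum_congr rfl
    intro L hL
    simp only [Finset.mem_filter, Finset.mem_univ, true_and] at hL
    rw [Finset.sum_const, smul_eq_mul, ← mul_assoc]
    by_cases h : v ∉ L
    · rw [if_pos h, lag_half B hnd hV hL.1 v h]
    · rw [if_neg h, Finset.filter_false_of_mem]
      · simp
      · rintro u - ⟨hu, huv⟩
        push Not at h
        rw [(hL.1 v).1 h u hu] at huv
        exact absurd huv (by decide)
  have h2 : ∑ L ∈ Finset.univ.filter (fun L => IsLag B L ∧ W ≤ L),
      ∑ u ∈ Finset.univ.filter (fun u : V => u ∈ L ∧ B u v = 1), f L =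
      ∑ u ∈ Finset.univ.filter (fun u : V => u ∈ B.orthogonal W ∧ B u v = 1), r * A := by
    have : ∑ L ∈ Finset.univ.filter (fun L => IsLag B L ∧ W ≤ L),
      ∑ u ∈ Finset.univ.filter (fun u : V => u ∈ L ∧ B u v = 1), f L =
      ∑ u ∈ Finset.univ.filter (fun u : V => u ∈ B.orthogonal W ∧ B u v = 1),
      ∑ L ∈ Finset.univ.filter (fun L => (IsLag B L ∧ W ≤ L) ∧ u ∈ L), f L := by
      apply Finset.sum_comm'
      intro L u
      simp only [Finset.mem_filter, Finset.mem_univ, true_and,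
        LinearMap.BilinForm.mem_orthogonal_iff]
      constructor
      · rintro ⟨⟨h1, h2⟩, h3, h4⟩
        exact ⟨⟨⟨h1, h2⟩, h3⟩, fun w hw => (h1 u).1 h3 w (h2 hw), h4⟩
      · rintro ⟨⟨⟨h1, h2⟩, h3⟩, h5, h4⟩
        exact ⟨⟨h1, h2⟩, h3, h4⟩
    rw [this]
    apply Finset.sum_congr rfl
    intro u hu
    simp only [Finset.mem_filter, Finset.mem_univ, true_and,
        LinearMap.BilinForm.mem_orthogonal_iff] at hu
    obtain ⟨hu, huv⟩ := hu
    have hfix : ∀ w ∈ W, transv B hs ha (u + v) w = w := by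
      intro w hw
      rw [transv_apply, map_add, LinearMap.add_apply, hs u w, hu w hw, (hM w).1 (hW hw) v hv,
        add_zero, zero_smul, add_zero]
    have hTv : transv B hs ha (u + v) v = u := by
      rw [transv_apply, map_add, LinearMap.add_apply, ha, huv, add_zero, one_smul,
        add_comm u v, ← add_assoc, zmod2_add_self, zero_add]
    have hTu : transv B hs ha (u + v) u = v := by
      have := transv_transv B hs ha (u + v) v
      rwa [hTv] at this
    have hWt : ∀ L, W ≤ L → W ≤ tmap B hs ha (u + v) L := by
      intro L hL w hw
      rw [mem_tmap, hfix w hw]; exact hL hw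
    rw [hA, lagSum_eq, Finset.mul_sum]
    refine Finset.sum_bij' (fun L _ => tmap B hs ha (u + v) L)
      (fun L _ => tmap B hs ha (u + v) L) ?_ ?_ ?_ ?_ ?_
    · intro L hL
      simp only [Finset.mem_filter, Finset.mem_univ, true_and, sup_le_iff,
        Submodule.span_singleton_le_iff_mem] at hL ⊢
      refine ⟨tmap_isLag B hs ha _ L hL.1.1, hWt L hL.1.2, ?_⟩
      rw [mem_tmap, hTv]; exact hL.2
    · intro L hL
      simp only [Finset.mem_filter, Finset.mem_univ, true_and, sup_le_iff,
        Submodule.span_singleton_le_iff_mem] at hL ⊢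
      refine ⟨⟨tmap_isLag B hs ha _ L hL.1, hWt L hL.2.1⟩, ?_⟩
      rw [mem_tmap, hTu]; exact hL.2.2
    · intro L _; exact tmap_tmap B hs ha _ L
    · intro L _; exact tmap_tmap B hs ha _ L
    · intro L hL
      simp only [Finset.mem_filter, Finset.mem_univ, true_and] at hL
      have hx := exchange_finrank B hs ha hM hL.1.1 hv hL.2 huv
      have hle : Module.finrank (ZMod 2) (tmap B hs ha (u + v) L ⊓ M : Submodule (ZMod 2) V)
          ≤ n := by
        rw [← lag_finrank B hnd hV hM]; exact Submodule.finrank_mono inf_le_right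
      rw [hf]
      simp only
      rw [hx] at hle ⊢
      rw [← pow_succ']
      congr 1
      omega
  rw [h2, Finset.sum_const, smul_eq_mul, ← mul_assoc, perp_half B hs hnd hV W v hvW] at h1
  have h3 : 2 * n - Module.finrank (ZMod 2) W = n + (n - Module.finrank (ZMod 2) W) := by omega
  rw [h3, pow_add, mul_assoc] at h1
  have h4 := Nat.eq_of_mul_eq_mul_left (by positivity) h1
  rw [hsplit, h4]; ring

lemma lagSum_formula {n r : ℕ} (B : LinearMap.BilinForm (ZMod 2) V) (hs : ∀ u v, B u v = B v u)
    (ha : ∀ u, B u u = 0)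
    (hnd : B.Nondegenerate) (hV : Module.finrank (ZMod 2) V = 2 * n)
    {M : Submodule (ZMod 2) V} (hM : IsLag B M) (j : ℕ) :
    ∀ W : Submodule (ZMod 2) V, W ≤ M → Module.finrank (ZMod 2) W + j = n →
    lagSum B M n r W = ∏ i ∈ Finset.range j, (1 + r * 2 ^ (i + 1)) := by
  induction j with
  | zero =>
    intro W hW h
    have : W = M := by
      apply Submodule.eq_of_le_of_finrank_eq hW
      rw [lag_finrank B hnd hV hM]; omega
    rw [this, lagSum_top B hnd hV hM]; simp
  | succ j ih =>
    intro W hW h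
    have hne : ∃ v ∈ M, v ∉ W := by
      by_contra hcon
      push Not at hcon
      have : W = M := le_antisymm hW hcon
      rw [this, lag_finrank B hnd hV hM] at h
      omega
    obtain ⟨v, hv, hvW⟩ := hne
    rw [lagSum_step B hs ha hnd hV hM W hW v hv hvW, ih, Finset.prod_range_succ, mul_comm]
    · congr 4; omega
    · exact sup_le hW ((Submodule.span_singleton_le_iff_mem _ _).2 hv)
    · have hd : Disjoint W (Submodule.span (ZMod 2) {v}) := by
        rw [Submodule.disjoint_span_singleton]
        intro h
        exact absurd h hvW
      have hv0 : v ≠ 0 := fun h => hvW (h ▸ W.zero_mem)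
      have := Submodule.finrank_sup_add_finrank_inf_eq W (Submodule.span (ZMod 2) {v})
      rw [hd.eq_bot, finrank_bot, finrank_span_singleton hv0] at this
      omega

end SymplecticCounting
section PauliOps

/-- labels of Pauli operators modulo phase -/
abbrev PV (n : ℕ) : Type := (Fin n → ZMod 2) × (Fin n → ZMod 2)

/-- the sign character -/
def chi (a : ZMod 2) : ℂ := (-1) ^ a.val

lemma chi_zero : chi 0 = 1 := by simp [chi]
lemma chi_one : chi 1 = -1 := by simp [chi, ZMod.val_one]

lemma zmod2_cases (a : ZMod 2) : a = 0 ∨ a = 1 := by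
  revert a; decide

lemma zmod2_one_add_one : (1 : ZMod 2) + 1 = 0 := by decide

lemma chi_add (a b : ZMod 2) : chi (a + b) = chi a * chi b := by
  rcases zmod2_cases a with rfl | rfl <;> rcases zmod2_cases b with rfl | rfl <;>
    simp [chi_zero, chi_one, zmod2_one_add_one]

lemma chi_mul_self (a : ZMod 2) : chi a * chi a = 1 := by
  rcases zmod2_cases a with rfl | rfl <;> simp [chi_zero, chi_one]

lemma chi_ne_zero (a : ZMod 2) : chi a ≠ 0 := by
  intro h
  have := chi_mul_self a
  simp [h] at this

lemma chi_conj (a : ZMod 2) : (starRingEnd ℂ) (chi a) = chi a := by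
  rcases zmod2_cases a with rfl | rfl <;> simp [chi_zero, chi_one]

lemma chi_inj {a b : ZMod 2} (h : chi a = chi b) : a = b := by
  rcases zmod2_cases a with rfl | rfl <;> rcases zmod2_cases b with rfl | rfl <;>
    simp only [chi_zero, chi_one] at h ⊢ <;> norm_num at h

lemma chi_sum {ι : Type} (s : Finset ι) (f : ι → ZMod 2) :
    chi (∑ i ∈ s, f i) = (-1) ^ (∑ i ∈ s, (f i).val) := by
  classical
  induction s using Finset.induction_on with
  | empty => simp [chi_zero]
  | insert a s ha ih => rw [Finset.sum_insert ha, Finset.sum_insert ha, chi_add, ih, pow_add]; rfl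

variable {n : ℕ}

lemma bit_add_self (x : Fin n → ZMod 2) : x + x = 0 := zmod2_add_self x

lemma bit_add_add (b x : Fin n → ZMod 2) : b + x + x = b := by
  rw [add_assoc, bit_add_self, add_zero]

/-- phase-free Pauli operator -/
def pop (v : PV n) : QState n →ₗ[ℂ] QState n where
  toFun ψ := fun b => chi (v.2 ⬝ᵥ (b + v.1)) * ψ (b + v.1)
  map_add' ψ φ := by funext b; simp [mul_add]
  map_smul' c ψ := by funext b; simp; ring

lemma pop_apply (v : PV n) (ψ : QState n) (b : Fin n → ZMod 2) :
    pop v ψ b = chi (v.2 ⬝ᵥ (b + v.1)) * ψ (b + v.1) := rfl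

lemma pauliFun_eq (k : ZMod 4) (x z : Fin n → ZMod 2) (ψ : QState n) :
    pauliFun n k x z ψ = (Complex.I ^ k.val) • pop (x, z) ψ := by
  funext b
  simp only [pauliFun, Pi.smul_apply, pop_apply, smul_eq_mul, dotProduct, chi_sum, mul_assoc,
    Pi.add_apply]

lemma pop_mul (u v : PV n) (ψ : QState n) :
    pop u (pop v ψ) = chi (u.2 ⬝ᵥ v.1) • pop (u + v) ψ := by
  funext b
  simp only [pop_apply, Pi.smul_apply, smul_eq_mul, Prod.fst_add, Prod.snd_add]
  rw [← add_assoc b, ← mul_assoc, ← mul_assoc, ← chi_add, ← chi_add]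
  congr 2
  simp only [add_dotProduct, dotProduct_add]
  have : ∀ c d : ZMod 2, d = c + (d + c) := by decide
  have h2 := this (u.2 ⬝ᵥ v.1)
  generalize u.2 ⬝ᵥ v.1 = c at *
  rw [h2 (u.2 ⬝ᵥ b + u.2 ⬝ᵥ u.1 + (v.2 ⬝ᵥ b + v.2 ⬝ᵥ u.1 + v.2 ⬝ᵥ v.1))]
  ring

/-- symplectic form -/
def symp (n : ℕ) : LinearMap.BilinForm (ZMod 2) (PV n) :=
  LinearMap.mk₂ (ZMod 2) (fun u v => u.1 ⬝ᵥ v.2 + u.2 ⬝ᵥ v.1)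
    (by intro a b c; simp only [Prod.fst_add, Prod.snd_add, add_dotProduct]; ring)
    (by intro a b c; simp only [Prod.smul_fst, Prod.smul_snd, smul_dotProduct, smul_add])
    (by intro a b c; simp only [Prod.fst_add, Prod.snd_add, dotProduct_add]; ring)
    (by intro a b c; simp only [Prod.smul_fst, Prod.smul_snd, dotProduct_smul, smul_add])

lemma symp_apply (u v : PV n) : symp n u v = u.1 ⬝ᵥ v.2 + u.2 ⬝ᵥ v.1 := rfl

lemma symp_symm (u v : PV n) : symp n u v = symp n v u := by
  rw [symp_apply, symp_apply, dotProduct_comm u.1, dotProduct_comm u.2, add_comm]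

lemma symp_self (u : PV n) : symp n u u = 0 := by
  rw [symp_apply, dotProduct_comm u.1]
  exact zmod2_add_self (V := ZMod 2) _

lemma symp_nondeg : (symp n).Nondegenerate := by
  have h : ∀ u : PV n, (∀ v, symp n u v = 0) → u = 0 := by
    intro u hu
    have h1 : u.1 = 0 := by
      funext i
      have := hu (0, Pi.single i 1)
      simpa [symp_apply] using this
    have h2 : u.2 = 0 := by
      funext i
      have := hu (Pi.single i 1, 0)
      simpa [symp_apply] using this
    exact Prod.ext h1 h2
  exact ⟨h, fun u hu => h u (fun v => by rw [symp_symm]; exact hu v)⟩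

lemma finrank_PV : Module.finrank (ZMod 2) (PV n) = 2 * n := by
  rw [Module.finrank_prod]; simp; ring

lemma pop_comm (u v : PV n) (ψ : QState n) :
    pop u (pop v ψ) = chi (symp n u v) • pop v (pop u ψ) := by
  rw [pop_mul, pop_mul, smul_smul, ← chi_add, add_comm u v, symp_apply, dotProduct_comm v.2]
  congr 2
  have : ∀ c d : ZMod 2, d = c + d + c := by decide
  exact this _ _

lemma pop_zero (ψ : QState n) : pop 0 ψ = ψ := by
  funext b; simp [pop_apply, chi_zero]

lemma pop_sq (u : PV n) (ψ : QState n) : pop u (pop u ψ) = chi (u.2 ⬝ᵥ u.1) • ψ := by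
  rw [pop_mul, zmod2_add_self, pop_zero]

lemma qInner_add_right (ψ φ₁ φ₂ : QState n) :
    qInner ψ (φ₁ + φ₂) = qInner ψ φ₁ + qInner ψ φ₂ := by
  simp [qInner, mul_add, Finset.sum_add_distrib]

lemma qInner_smul_right (c : ℂ) (ψ φ : QState n) : qInner ψ (c • φ) = c * qInner ψ φ := by
  simp only [qInner, Finset.mul_sum, Pi.smul_apply, smul_eq_mul]
  exact Finset.sum_congr rfl (fun _ _ => by ring)

lemma qInner_smul_left (c : ℂ) (ψ φ : QState n) :
    qInner (c • ψ) φ = (starRingEnd ℂ) c * qInner ψ φ := by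
  simp only [qInner, Finset.mul_sum, Pi.smul_apply, smul_eq_mul, map_mul]
  exact Finset.sum_congr rfl (fun _ _ => by ring)

lemma qInner_conj (ψ φ : QState n) : (starRingEnd ℂ) (qInner ψ φ) = qInner φ ψ := by
  simp only [qInner, map_sum, map_mul, Complex.conj_conj]
  exact Finset.sum_congr rfl (fun _ _ => by ring)

lemma qInner_self (ψ : QState n) : qInner ψ ψ = ((∑ b, Complex.normSq (ψ b) : ℝ) : ℂ) := by
  simp only [qInner, Complex.ofReal_sum]
  exact Finset.sum_congr rfl (fun b _ => by rw [Complex.normSq_eq_conj_mul_self])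

lemma qInner_self_eq_zero {ψ : QState n} : qInner ψ ψ = 0 ↔ ψ = 0 := by
  constructor
  · intro h
    rw [qInner_self] at h
    have h2 : ∑ b, Complex.normSq (ψ b) = 0 := by exact_mod_cast h
    rw [Finset.sum_eq_zero_iff_of_nonneg (fun _ _ => Complex.normSq_nonneg _)] at h2
    funext b
    exact Complex.normSq_eq_zero.1 (h2 b (Finset.mem_univ b))
  · rintro rfl; simp [qInner]

lemma qInner_pop (v : PV n) (ψ φ : QState n) : qInner (pop v ψ) (pop v φ) = qInner ψ φ := by
  simp only [qInner]
  rw [← Equiv.sum_comp (Equiv.addRight v.1) (fun b => (starRingEnd ℂ) (ψ b) * φ b)]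
  apply Finset.sum_congr rfl
  intro b _
  simp only [pop_apply, map_mul, chi_conj, Equiv.coe_addRight]
  linear_combination ((starRingEnd ℂ) (ψ (b + v.1)) * φ (b + v.1)) *
    chi_mul_self (v.2 ⬝ᵥ (b + v.1))

lemma pop_ne_zero {v : PV n} {ψ : QState n} (h : ψ ≠ 0) : pop v ψ ≠ 0 := by
  intro h2
  apply h
  rw [← qInner_self_eq_zero, ← qInner_pop v, h2]; simp [qInner]

lemma pop_inj {u v : PV n} {a c : ℂ} (ha : a ≠ 0)
    (h : ∀ φ : QState n, a • pop u φ = c • pop v φ) : u = v := by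
  have h1 : u.1 = v.1 := by
    by_contra hne
    have := congrFun (h (Pi.single 0 1)) u.1
    have hne2 : u.1 + v.1 ≠ 0 := by
      intro h0
      apply hne
      rw [← bit_add_add u.1 v.1, h0, zero_add]
    simp [pop_apply, bit_add_self, hne2, ha, chi_ne_zero] at this
  have key : ∀ y, a * chi (u.2 ⬝ᵥ y) = c * chi (v.2 ⬝ᵥ y) := by
    intro y
    have := congrFun (h (fun _ => 1)) (y + u.1)
    simp only [Pi.smul_apply, pop_apply, smul_eq_mul, mul_one, ← h1, bit_add_add] at this
    exact this
  have hac : a = c := by simpa [chi_zero] using key 0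
  have h2 : u.2 = v.2 := by
    funext i
    have := key (Pi.single i 1)
    rw [← hac] at this
    have := chi_inj (mul_left_cancel₀ ha this)
    simpa using this
  exact Prod.ext h1 h2

/-- labels for which `φ` is an eigenvector -/
def eigSub (φ : QState n) : Submodule (ZMod 2) (PV n) where
  carrier := {v | ∃ c : ℂ, pop v φ = c • φ}
  zero_mem' := ⟨1, by rw [pop_zero, one_smul]⟩
  add_mem' := by
    rintro u v ⟨c, hc⟩ ⟨d, hd⟩
    refine ⟨chi (u.2 ⬝ᵥ v.1) * (d * c), ?_⟩
    have h := pop_mul u v φ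
    rw [hd, map_smul, hc, smul_smul] at h
    rw [mul_smul, h, smul_smul, chi_mul_self, one_smul]
  smul_mem' := by
    intro a v hv
    rcases zmod2_cases a with rfl | rfl
    · rw [zero_smul]; exact ⟨1, by rw [pop_zero, one_smul]⟩
    · rw [one_smul]; exact hv

lemma mem_eigSub {φ : QState n} {v : PV n} : v ∈ eigSub φ ↔ ∃ c : ℂ, pop v φ = c • φ := Iff.rfl

lemma eig_unit {φ : QState n} (h0 : φ ≠ 0) {v : PV n} {c : ℂ} (h : pop v φ = c • φ) :
    (starRingEnd ℂ) c * c = 1 := by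
  have h1 := qInner_pop v φ φ
  rw [h, qInner_smul_left, qInner_smul_right, ← mul_assoc] at h1
  have h2 : qInner φ φ ≠ 0 := fun h => h0 (qInner_self_eq_zero.1 h)
  exact mul_right_cancel₀ h2 (by rw [h1, one_mul])

lemma eig_ne_zero {φ : QState n} (h0 : φ ≠ 0) {v : PV n} {c : ℂ} (h : pop v φ = c • φ) :
    c ≠ 0 := by
  intro hc
  have := eig_unit h0 h
  simp [hc] at this

lemma eig_same {φ ψ : QState n} (h0 : φ ≠ 0) {v : PV n} {c d : ℂ}
    (h : pop v φ = c • φ) (h' : pop v ψ = d • ψ) (hne : qInner φ ψ ≠ 0) : c = d := by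
  have h1 := qInner_pop v φ ψ
  rw [h, h', qInner_smul_left, qInner_smul_right, ← mul_assoc] at h1
  have h2 : (starRingEnd ℂ) c * d = 1 := mul_right_cancel₀ hne (by rw [h1, one_mul])
  have h3 := eig_unit h0 h
  have h4 : (starRingEnd ℂ) c ≠ 0 := by
    intro h; simp [h] at h3
  exact mul_left_cancel₀ h4 (h3.trans h2.symm)

lemma eig_shift {φ : QState n} {u w : PV n} {c : ℂ} (h : pop w φ = c • φ) :
    pop w (pop u φ) = (chi (symp n w u) * c) • pop u φ := by
  rw [pop_comm, h, map_smul, smul_smul]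

lemma eigSub_isotropic {φ : QState n} (h0 : φ ≠ 0) {u v : PV n} (hu : u ∈ eigSub φ)
    (hv : v ∈ eigSub φ) : symp n u v = 0 := by
  obtain ⟨c, hc⟩ := hu
  obtain ⟨d, hd⟩ := hv
  have h := pop_comm u v φ
  rw [hc, hd, map_smul, map_smul, hc, hd, smul_smul, smul_smul, smul_smul] at h
  have h2 := smul_left_injective ℂ h0 h
  have hcd : d * c ≠ 0 := mul_ne_zero (eig_ne_zero h0 hd) (eig_ne_zero h0 hc)
  apply chi_inj
  rw [chi_zero]
  apply mul_right_cancel₀ hcd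
  rw [one_mul]
  linear_combination -h2

lemma pow4_root {c : ℂ} (h : c * c = 1 ∨ c * c = -1) : ∃ k : ZMod 4, c = Complex.I ^ k.val := by
  rcases h with h | h
  · rcases mul_self_eq_one_iff.1 h with rfl | rfl
    · exact ⟨0, by simp⟩
    · refine ⟨2, ?_⟩
      have : (2 : ZMod 4).val = 2 := rfl
      rw [this, Complex.I_sq]
  · have h2 : c * c = Complex.I * Complex.I := by rw [h, Complex.I_mul_I]
    rcases mul_self_eq_mul_self_iff.1 h2 with rfl | rfl
    · refine ⟨1, ?_⟩
      have : (1 : ZMod 4).val = 1 := rfl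
      rw [this, pow_one]
    · refine ⟨3, ?_⟩
      have : (3 : ZMod 4).val = 3 := rfl
      rw [this, Complex.I_pow_three]

lemma stab_ncard {ψ : QState n} (h0 : ψ ≠ 0) :
    (stabGroup n ψ).ncard = Nat.card (eigSub ψ) := by
  choose! c hc using fun (v : PV n) (hv : v ∈ eigSub ψ) => mem_eigSub.1 hv
  have hmem : ∀ v ∈ eigSub ψ, (fun φ => (c v)⁻¹ • pop v φ) ∈ stabGroup n ψ := by
    intro v hv
    have hcv := hc v hv
    have hne := eig_ne_zero h0 hcv
    constructor
    · have hsq : c v * c v = chi (v.2 ⬝ᵥ v.1) := by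
        have := pop_sq v ψ
        rw [hcv, map_smul, hcv, smul_smul] at this
        exact smul_left_injective ℂ h0 this
      have : (c v)⁻¹ * (c v)⁻¹ = 1 ∨ (c v)⁻¹ * (c v)⁻¹ = -1 := by
        rw [← mul_inv, hsq]
        rcases zmod2_cases (v.2 ⬝ᵥ v.1) with h | h <;> rw [h]
        · left; simp [chi_zero]
        · right; rw [chi_one]; norm_num
      obtain ⟨k, hk⟩ := pow4_root this
      refine ⟨k, v.1, v.2, ?_⟩
      funext φ
      rw [pauliFun_eq, hk]
    · change (c v)⁻¹ • pop v ψ = ψ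
      rw [hcv, smul_smul, inv_mul_cancel₀ hne, one_smul]
  rw [← Nat.card_coe_set_eq]
  symm
  refine Nat.card_eq_of_bijective
    (fun v : eigSub ψ => (⟨_, hmem v.1 v.2⟩ : stabGroup n ψ)) ⟨?_, ?_⟩
  · intro u v huv
    have := congrArg Subtype.val huv
    apply Subtype.ext
    refine pop_inj (a := (c u)⁻¹) (c := (c v)⁻¹) (inv_ne_zero (eig_ne_zero h0 (hc _ u.2))) ?_
    intro φ
    exact congrFun this φ
  · rintro ⟨U, ⟨k, x, z, rfl⟩, hU⟩
    rw [pauliFun_eq] at hU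
    have hI : (Complex.I ^ k.val) ≠ 0 := pow_ne_zero _ Complex.I_ne_zero
    have hv : pop (x, z) ψ = (Complex.I ^ k.val)⁻¹ • ψ := by
      conv_rhs => rw [← hU]
      rw [smul_smul, inv_mul_cancel₀ hI, one_smul]
    have hm : (x, z) ∈ eigSub ψ := ⟨_, hv⟩
    refine ⟨⟨(x, z), hm⟩, ?_⟩
    apply Subtype.ext
    funext φ
    change (c (x, z))⁻¹ • pop (x, z) φ = pauliFun n k x z φ
    rw [pauliFun_eq]
    congr 1
    have h3 := hc _ hm
    rw [hv] at h3
    rw [← smul_left_injective ℂ h0 h3, inv_inv]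

lemma ne_zero_of_unit {ψ : QState n} (h : qInner ψ ψ = 1) : ψ ≠ 0 := by
  rintro rfl
  simp [qInner] at h

lemma isotropic_isLag {L : Submodule (ZMod 2) (PV n)}
    (h : ∀ u ∈ L, ∀ v ∈ L, symp n u v = 0) (hc : Nat.card L = 2 ^ n) : IsLag (symp n) L := by
  have hr : Module.finrank (ZMod 2) L = n := by
    rw [Module.natCard_eq_pow_finrank (K := ZMod 2), Nat.card_zmod] at hc
    exact Nat.pow_right_injective le_rfl hc
  have hle : L ≤ (symp n).orthogonal L := by
    intro v hv
    rw [LinearMap.BilinForm.mem_orthogonal_iff]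
    exact fun u hu => h u hu v hv
  have heq : L = (symp n).orthogonal L := by
    apply Submodule.eq_of_le_of_finrank_eq hle
    rw [LinearMap.BilinForm.finrank_orthogonal symp_nondeg, finrank_PV, hr]; omega
  intro v
  rw [← LinearMap.BilinForm.mem_orthogonal_iff, ← heq]

lemma lag_card {L : Submodule (ZMod 2) (PV n)} (hL : IsLag (symp n) L) :
    Nat.card L = 2 ^ n := by
  rw [Module.natCard_eq_pow_finrank (K := ZMod 2), Nat.card_zmod,
    lag_finrank _ symp_nondeg finrank_PV hL]

lemma stab_isLag {ψ : QState n} (h : IsStabilizerState n ψ) : IsLag (symp n) (eigSub ψ) := by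
  have h0 := ne_zero_of_unit h.1
  apply isotropic_isLag
  · exact fun u hu v hv => eigSub_isotropic h0 hu hv
  · rw [← stab_ncard h0, h.2]

lemma eigSub_eq {φ : QState n} (h0 : φ ≠ 0) {L : Submodule (ZMod 2) (PV n)}
    (hL : IsLag (symp n) L) (h : L ≤ eigSub φ) : eigSub φ = L := by
  apply le_antisymm _ h
  intro v hv
  rw [hL]
  exact fun u hu => eigSub_isotropic h0 (h hu) hv

lemma isStab_of_lag {φ : QState n} (h1 : qInner φ φ = 1) {L : Submodule (ZMod 2) (PV n)}
    (hL : IsLag (symp n) L) (h : L ≤ eigSub φ) : IsStabilizerState n φ := by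
  have h0 := ne_zero_of_unit h1
  refine ⟨h1, ?_⟩
  rw [stab_ncard h0, eigSub_eq h0 hL h, lag_card hL]

lemma eigSub_smul {φ : QState n} {c : ℂ} : eigSub φ ≤ eigSub (c • φ) := by
  rintro v ⟨d, hd⟩
  exact ⟨d, by rw [map_smul, hd, smul_comm]⟩

lemma eigSub_pop {φ : QState n} (u : PV n) : eigSub φ ≤ eigSub (pop u φ) := by
  rintro v ⟨d, hd⟩
  exact ⟨_, eig_shift hd⟩

/-- A nonzero vector is not orthogonal to all Pauli translates of a nonzero vector. -/
lemma exists_pop_inner {φ φ0 : QState n} (h : φ ≠ 0) (h0 : φ0 ≠ 0) :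
    ∃ u, qInner φ (pop u φ0) ≠ 0 := by
  by_contra hcon
  push Not at hcon
  obtain ⟨a, ha⟩ := Function.ne_iff.1 h
  obtain ⟨b, hb⟩ := Function.ne_iff.1 h0
  simp only [Pi.zero_apply] at ha hb
  set x := a + b with hx
  have hax : a + x = b := by rw [hx, ← add_assoc, bit_add_self, zero_add]
  have key : ∑ z : Fin n → ZMod 2, chi (z ⬝ᵥ b) * qInner φ (pop (x, z) φ0) = 0 :=
    Finset.sum_eq_zero (fun z _ => by rw [hcon, mul_zero])
  simp only [qInner, pop_apply, Finset.mul_sum] at key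
  rw [Finset.sum_comm, Finset.sum_eq_single a] at key
  · have : ∀ z : Fin n → ZMod 2, chi (z ⬝ᵥ b) * ((starRingEnd ℂ) (φ a) *
        (chi (z ⬝ᵥ (a + x)) * φ0 (a + x))) = (starRingEnd ℂ) (φ a) * φ0 b := by
      intro z
      rw [hax]
      linear_combination ((starRingEnd ℂ) (φ a) * φ0 b) * chi_mul_self (z ⬝ᵥ b)
    simp only [this, Finset.sum_const, nsmul_eq_mul] at key
    have hcard : ((Finset.univ : Finset (Fin n → ZMod 2)).card : ℂ) ≠ 0 := by
      simp
    exact (mul_ne_zero hcard (mul_ne_zero ((map_ne_zero _).2 ha) hb)) key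
  · intro y _ hy
    have hy2 : b + (y + x) ≠ 0 := by
      intro h0
      apply hy
      have e : b + (y + x) = a + y + (b + b) := by rw [hx]; abel
      rw [e, bit_add_self, add_zero] at h0
      rw [← zero_add y, ← bit_add_self a, add_assoc, h0, add_zero]
    obtain ⟨i, hi⟩ := Function.ne_iff.1 hy2
    have hi1 : (b + (y + x)) i = 1 := zmod2_eq_one hi
    have hsum : ∑ z : Fin n → ZMod 2, chi (z ⬝ᵥ (b + (y + x))) = 0 := by
      have h1 : ∑ z : Fin n → ZMod 2, chi (z ⬝ᵥ (b + (y + x))) =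
          ∑ z : Fin n → ZMod 2, - chi (z ⬝ᵥ (b + (y + x))) := by
        rw [← Equiv.sum_comp (Equiv.addRight (Pi.single i 1))]
        apply Finset.sum_congr rfl
        intro z _
        rw [Equiv.coe_addRight, add_dotProduct, single_dotProduct, hi1, one_mul, chi_add, chi_one]
        ring
      rw [Finset.sum_neg_distrib] at h1
      exact self_eq_neg.1 h1
    have h2 : ∀ z : Fin n → ZMod 2, chi (z ⬝ᵥ b) * ((starRingEnd ℂ) (φ y) *
        (chi (z ⬝ᵥ (y + x)) * φ0 (y + x))) =
        ((starRingEnd ℂ) (φ y) * φ0 (y + x)) * chi (z ⬝ᵥ (b + (y + x))) := by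
      intro z
      rw [dotProduct_add z b (y + x), chi_add]; ring
    rw [Finset.sum_congr rfl (fun z _ => h2 z), ← Finset.mul_sum, hsum, mul_zero]
  · intro h; exact absurd (Finset.mem_univ a) h

/-- Two states with overlap and with the same Lagrangian are parallel. -/
lemma parallel_of_same {L : Submodule (ZMod 2) (PV n)} (hL : IsLag (symp n) L)
    {φ φ1 : QState n} (h1 : qInner φ1 φ1 = 1) (hφ : L ≤ eigSub φ) (hφ1 : L ≤ eigSub φ1)
    (hne : qInner φ1 φ ≠ 0) : φ = qInner φ1 φ • φ1 := by
  have h10 := ne_zero_of_unit h1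
  set φ' := φ + (-(qInner φ1 φ)) • φ1 with hφ'
  by_contra hcon
  have h0 : φ' ≠ 0 := by
    intro h
    apply hcon
    rw [hφ', neg_smul, ← sub_eq_add_neg, sub_eq_zero] at h
    exact h
  have horth : qInner φ1 φ' = 0 := by
    rw [hφ', qInner_add_right, qInner_smul_right, h1]; ring
  obtain ⟨u, hu⟩ := exists_pop_inner h0 h10
  by_cases huL : u ∈ L
  · obtain ⟨c, hc⟩ := hφ1 huL
    rw [hc, qInner_smul_right, ← qInner_conj, horth] at hu
    simp at hu
  · rw [hL] at huL
    push Not at huL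
    obtain ⟨w, hw, hwu⟩ := huL
    obtain ⟨c, hc⟩ := hφ1 hw
    obtain ⟨d, hd⟩ := hφ hw
    have hcd := eig_same h10 hc hd hne
    have hφ'w : pop w φ' = c • φ' := by
      rw [hφ', map_add, map_smul, hc, hd, ← hcd, smul_add, smul_comm]
    have := eig_same h0 hφ'w (eig_shift (u := u) hc) hu
    rw [zmod2_eq_one hwu, chi_one] at this
    have hc0 := eig_ne_zero h10 hc
    apply hc0
    linear_combination (1 / 2) * this

/-- existence of a joint eigenvector overlapping with `ψ` -/
lemma exists_joint {ψ : QState n} (h0 : ψ ≠ 0) {L : Submodule (ZMod 2) (PV n)}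
    (hL : IsLag (symp n) L) (S : Finset (PV n)) :
    (∀ v ∈ S, v ∈ L) → ∃ φ, qInner ψ φ ≠ 0 ∧ ∀ v ∈ S, v ∈ eigSub φ := by
  classical
  induction S using Finset.induction_on with
  | empty => exact fun _ => ⟨ψ, fun h => h0 (qInner_self_eq_zero.1 h), by simp⟩
  | insert v S hvS ih =>
    intro hS
    obtain ⟨φ, hφ, hφS⟩ := ih (fun u hu => hS u (Finset.mem_insert_of_mem hu))
    have hvL := hS v (Finset.mem_insert_self v S)
    have hc : ∃ c : ℂ, c ≠ 0 ∧ c * c = chi (v.2 ⬝ᵥ v.1) := by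
      rcases zmod2_cases (v.2 ⬝ᵥ v.1) with h | h <;> rw [h]
      · exact ⟨1, one_ne_zero, by simp [chi_zero]⟩
      · exact ⟨Complex.I, Complex.I_ne_zero, by simp [chi_one]⟩
    obtain ⟨c, hc0, hcc⟩ := hc
    have hgen : ∀ d : ℂ, d * d = chi (v.2 ⬝ᵥ v.1) →
        ∀ u ∈ insert v S, u ∈ eigSub (d • φ + pop v φ) := by
      intro d hd u hu
      rcases Finset.mem_insert.1 hu with rfl | hu'
      · refine ⟨d, ?_⟩
        rw [map_add, map_smul, pop_sq, ← hd, smul_add, smul_smul, add_comm]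
      · obtain ⟨e, he⟩ := hφS u hu'
        refine ⟨e, ?_⟩
        have h1 := eig_shift (u := v) he
        rw [(hL v).1 hvL u (hS u hu), chi_zero, one_mul] at h1
        rw [map_add, map_smul, h1, he, smul_add, smul_comm]
    by_cases hA : qInner ψ (c • φ + pop v φ) = 0
    · refine ⟨(-c) • φ + pop v φ, ?_, hgen (-c) (by rw [← hcc]; ring)⟩
      intro hB
      rw [qInner_add_right, qInner_smul_right] at hA hB
      have : c * qInner ψ φ = 0 := by linear_combination (1 / 2) * hA - (1 / 2) * hB
      exact (mul_ne_zero hc0 hφ) this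
    · exact ⟨_, hA, hgen c hcc⟩

lemma exists_normalize {φ : QState n} (h0 : φ ≠ 0) : ∃ c : ℂ, c ≠ 0 ∧ qInner (c • φ) (c • φ) = 1 := by
  have hs : qInner φ φ ≠ 0 := fun h => h0 (qInner_self_eq_zero.1 h)
  rw [qInner_self] at hs
  set s : ℝ := ∑ b, Complex.normSq (φ b) with hsdef
  have hs0 : 0 ≤ s := Finset.sum_nonneg (fun _ _ => Complex.normSq_nonneg _)
  have hs1 : s ≠ 0 := by exact_mod_cast hs
  have hq : Real.sqrt s * Real.sqrt s = s := Real.mul_self_sqrt hs0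
  have hq0 : Real.sqrt s ≠ 0 := by
    intro h; rw [h] at hq; apply hs1; linarith
  refine ⟨(((Real.sqrt s)⁻¹ : ℝ) : ℂ), by exact_mod_cast inv_ne_zero hq0, ?_⟩
  rw [qInner_smul_left, qInner_smul_right, Complex.conj_ofReal, qInner_self, ← hsdef]
  have : (Real.sqrt s)⁻¹ * ((Real.sqrt s)⁻¹ * s) = 1 := by
    field_simp
    nlinarith [hq]
  exact_mod_cast this

lemma exists_base {ψ : QState n} (h0 : ψ ≠ 0) {L : Submodule (ZMod 2) (PV n)}
    (hL : IsLag (symp n) L) :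
    ∃ φ, qInner φ φ = 1 ∧ L ≤ eigSub φ ∧ qInner ψ φ ≠ 0 := by
  classical
  obtain ⟨φ, h1, h2⟩ := exists_joint h0 hL (Finset.univ.filter (fun v => v ∈ L)) (by simp)
  have hφ0 : φ ≠ 0 := by
    rintro rfl; simp [qInner] at h1
  obtain ⟨c, hc0, hc⟩ := exists_normalize hφ0
  refine ⟨c • φ, hc, fun v hv => eigSub_smul (h2 v (by simp [hv])), ?_⟩
  rw [qInner_smul_right]
  exact mul_ne_zero hc0 h1

end PauliOps
section Assembly

variable {n : ℕ}

lemma parallel_equiv {P : QState n → Prop} :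
    Equivalence (fun ψ φ : {ψ : QState n // IsStabilizerState n ψ ∧ P ψ} =>
      Parallel ψ.1 φ.1) where
  refl ψ := ⟨1, by rw [one_smul]⟩
  symm := by
    rintro ψ φ ⟨c, hc⟩
    have hc0 : c ≠ 0 := by
      rintro rfl
      rw [zero_smul] at hc
      exact ne_zero_of_unit φ.2.1.1 hc
    exact ⟨c⁻¹, by rw [hc, smul_smul, inv_mul_cancel₀ hc0, one_smul]⟩
  trans := by
    rintro a b c ⟨x, hx⟩ ⟨y, hy⟩
    exact ⟨y * x, by rw [hy, hx, smul_smul]⟩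

lemma sup_witness {L M : Submodule (ZMod 2) (PV n)} (hL : IsLag (symp n) L)
    (hM : IsLag (symp n) M) {u : PV n} (hu : u ∉ L ⊔ M) :
    ∃ w, w ∈ L ∧ w ∈ M ∧ symp n w u = 1 := by
  by_contra hcon
  push Not at hcon
  apply hu
  have hr : (symp n).IsRefl := fun x y h => by rw [symp_symm]; exact h
  rw [← LinearMap.BilinForm.orthogonal_orthogonal symp_nondeg hr (L ⊔ M),
    LinearMap.BilinForm.mem_orthogonal_iff]
  intro w hw
  rw [LinearMap.BilinForm.mem_orthogonal_iff] at hw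
  by_contra h
  refine hcon w ((hL w).2 fun x hx => hw x (Submodule.mem_sup_left hx))
    ((hM w).2 fun x hx => hw x (Submodule.mem_sup_right hx)) (zmod2_eq_one h)

lemma pop_add_mem {φ : QState n} (h0 : φ ≠ 0) (u : PV n) {l : PV n} (hl : l ∈ eigSub φ) :
    ∃ c : ℂ, c ≠ 0 ∧ pop (u + l) φ = c • pop u φ := by
  obtain ⟨c, hc⟩ := hl
  have h := pop_mul u l φ
  rw [hc, map_smul] at h
  refine ⟨chi (u.2 ⬝ᵥ l.1) * c, mul_ne_zero (chi_ne_zero _) (eig_ne_zero h0 hc), ?_⟩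
  rw [mul_smul, h, smul_smul, chi_mul_self, one_smul]

lemma orth_iff {ψ φ : QState n} (hψ : ψ ≠ 0) (hφ : φ ≠ 0)
    {L M : Submodule (ZMod 2) (PV n)} (hL : IsLag (symp n) L)
    (hM : IsLag (symp n) M) (hLφ : L ≤ eigSub φ) (hMψ : M ≤ eigSub ψ)
    (hne : qInner ψ φ ≠ 0) (u : PV n) : qInner ψ (pop u φ) = 0 ↔ u ∉ L ⊔ M := by
  constructor
  · intro h hu
    obtain ⟨l, hl, m, hm, rfl⟩ := Submodule.mem_sup.1 hu
    rw [add_comm] at h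
    obtain ⟨c, hc0, hc⟩ := pop_add_mem hφ m (hLφ hl)
    rw [hc, qInner_smul_right] at h
    obtain ⟨d, hd⟩ := hMψ hm
    have h2 := qInner_pop m ψ φ
    rw [hd, qInner_smul_left] at h2
    rcases mul_eq_zero.1 h with h | h
    · exact hc0 h
    · rw [h, mul_zero] at h2
      exact hne h2.symm
  · intro hu
    by_contra h
    obtain ⟨w, hwL, hwM, hw⟩ := sup_witness hL hM hu
    obtain ⟨c, hc⟩ := hLφ hwL
    obtain ⟨d, hd⟩ := hMψ hwM
    have h1 := eig_same hψ hd hc hne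
    have h2 := eig_same hψ hd (eig_shift (u := u) hc) h
    rw [hw, chi_one] at h2
    apply eig_ne_zero hφ hc
    linear_combination (1 / 2) * h2 - (1 / 2) * h1

lemma mem_map_mkQ {L M : Submodule (ZMod 2) (PV n)} (u : PV n) :
    (Submodule.Quotient.mk u : PV n ⧸ L) ∈ M.map L.mkQ ↔ u ∈ L ⊔ M := by
  rw [← Submodule.comap_map_mkQ]; rfl

lemma card_compl {L M : Submodule (ZMod 2) (PV n)} (hL : IsLag (symp n) L)
    (hM : IsLag (symp n) M) :
    Nat.card {q : PV n ⧸ L // q ∉ M.map L.mkQ} +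
      2 ^ (n - Module.finrank (ZMod 2) (L ⊓ M : Submodule (ZMod 2) (PV n))) = 2 ^ n := by
  classical
  have h1 : Nat.card (PV n ⧸ L) = 2 ^ n := by
    have hL' := lag_finrank _ symp_nondeg finrank_PV hL
    have := Submodule.finrank_quotient_add_finrank L
    rw [hL', finrank_PV] at this
    rw [Module.natCard_eq_pow_finrank (K := ZMod 2), Nat.card_zmod]
    congr 1; omega
  have h2 : Nat.card (M.map L.mkQ) =
      2 ^ (n - Module.finrank (ZMod 2) (L ⊓ M : Submodule (ZMod 2) (PV n))) := by
    have hM' := lag_finrank _ symp_nondeg finrank_PV hM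
    have := LinearMap.finrank_range_add_finrank_ker (L.mkQ ∘ₗ M.subtype)
    rw [LinearMap.range_comp, Submodule.range_subtype, LinearMap.ker_comp, Submodule.ker_mkQ,
      hM'] at this
    have h3 : Module.finrank (ZMod 2) (L.comap M.subtype) =
        Module.finrank (ZMod 2) (L ⊓ M : Submodule (ZMod 2) (PV n)) := by
      rw [← (Submodule.comapSubtypeEquivOfLe (inf_le_right : L ⊓ M ≤ M)).finrank_eq]
      have : L.comap M.subtype = (L ⊓ M).comap M.subtype := by
        ext x; simp
      rw [this]
    rw [Module.natCard_eq_pow_finrank (K := ZMod 2), Nat.card_zmod]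
    congr 1; omega
  rw [← h1, ← h2]
  have : Fintype (PV n ⧸ L) := Fintype.ofFinite _
  have h4 : Nat.card (M.map L.mkQ) = Nat.card {q : PV n ⧸ L // q ∈ M.map L.mkQ} := rfl
  rw [h4]
  simp only [Nat.card_eq_fintype_card]
  rw [Fintype.card_subtype_compl]
  have := Fintype.card_subtype_le (fun q : PV n ⧸ L => q ∈ M.map L.mkQ)
  omega

lemma card_orth {ψ : QState n} (hψ : IsStabilizerState n ψ) :
    stabQuotCard n (fun φ => qInner ψ φ = 0) =
      Nat.card (Σ L : {L : Submodule (ZMod 2) (PV n) // IsLag (symp n) L},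
        {q : PV n ⧸ L.1 // q ∉ (eigSub ψ).map L.1.mkQ}) := by
  have hψ0 := ne_zero_of_unit hψ.1
  have hM := stab_isLag hψ
  choose base hb1 hb2 hb3 using
    fun L : {L : Submodule (ZMod 2) (PV n) // IsLag (symp n) L} => exists_base hψ0 L.2
  have hb0 : ∀ L, base L ≠ 0 := fun L => ne_zero_of_unit (hb1 L)
  have hmk : ∀ (L : {L : Submodule (ZMod 2) (PV n) // IsLag (symp n) L}) (q : PV n ⧸ L.1),
      (Submodule.Quotient.mk (Quotient.out q) : PV n ⧸ L.1) = q := fun L q => Quotient.out_eq q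
  have horth : ∀ (L : {L : Submodule (ZMod 2) (PV n) // IsLag (symp n) L}) (q : PV n ⧸ L.1),
      qInner ψ (pop (Quotient.out q) (base L)) = 0 ↔ q ∉ (eigSub ψ).map L.1.mkQ := by
    intro L q
    rw [orth_iff hψ0 (hb0 L) L.2 hM (hb2 L) le_rfl (hb3 L), ← mem_map_mkQ, hmk]
  have hunit : ∀ (L : {L : Submodule (ZMod 2) (PV n) // IsLag (symp n) L}) (u : PV n),
      qInner (pop u (base L)) (pop u (base L)) = 1 := fun L u => by rw [qInner_pop, hb1]
  have hstab : ∀ (L : {L : Submodule (ZMod 2) (PV n) // IsLag (symp n) L}) (u : PV n),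
      IsStabilizerState n (pop u (base L)) :=
    fun L u => isStab_of_lag (hunit L u) L.2 ((hb2 L).trans (eigSub_pop u))
  have hsub : ∀ (L : {L : Submodule (ZMod 2) (PV n) // IsLag (symp n) L}) (u : PV n),
      eigSub (pop u (base L)) = L.1 :=
    fun L u => eigSub_eq (ne_zero_of_unit (hunit L u)) L.2 ((hb2 L).trans (eigSub_pop u))
  rw [stabQuotCard]
  symm
  refine Nat.card_eq_of_bijective (fun t => Quot.mk _
    ⟨pop (Quotient.out t.2.1) (base t.1), hstab _ _, (horth _ _).2 t.2.2⟩) ⟨?_, ?_⟩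
  · rintro ⟨L, q, hq⟩ ⟨L', q', hq'⟩ h
    have h1 := (Equivalence.eqvGen_iff parallel_equiv).1 (Quot.eqvGen_exact h)
    obtain ⟨c, hc⟩ := h1
    change pop (Quotient.out q') (base L') = c • pop (Quotient.out q) (base L) at hc
    have hLL : L = L' := by
      apply Subtype.ext
      have hle : L.1 ≤ L'.1 := by
        rw [← hsub L (Quotient.out q), ← hsub L' (Quotient.out q'), hc]
        exact eigSub_smul
      apply Submodule.eq_of_le_of_finrank_eq hle
      rw [lag_finrank _ symp_nondeg finrank_PV L.2, lag_finrank _ symp_nondeg finrank_PV L'.2]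
    subst hLL
    have hqq : q = q' := by
      rw [← hmk L q, ← hmk L q']
      rw [Submodule.Quotient.eq]
      have h2 : Quotient.out q + Quotient.out q' ∈ eigSub (base L) := by
        have h3 := pop_mul (Quotient.out q) (Quotient.out q') (base L)
        rw [hc, map_smul, pop_sq, smul_smul] at h3
        have h4 := congrArg (fun x => chi ((Quotient.out q).2 ⬝ᵥ (Quotient.out q').1) • x) h3
        simp only [smul_smul, chi_mul_self, one_smul] at h4
        exact ⟨_, h4.symm⟩
      rw [eigSub_eq (hb0 L) L.2 (hb2 L)] at h2
      have e : Quotient.out q - Quotient.out q' = Quotient.out q + Quotient.out q' := by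
        rw [sub_eq_iff_eq_add, add_assoc, zmod2_add_self, add_zero]
      rw [e]; exact h2
    subst hqq
    rfl
  · intro x
    induction x using Quot.ind with
    | mk φ =>
    obtain ⟨φ, hφ, ho⟩ := φ
    change qInner ψ φ = 0 at ho
    let L : {L : Submodule (ZMod 2) (PV n) // IsLag (symp n) L} := ⟨eigSub φ, stab_isLag hφ⟩
    have hφ0 := ne_zero_of_unit hφ.1
    obtain ⟨u, hu⟩ := exists_pop_inner hφ0 (hb0 L)
    let q : PV n ⧸ L.1 := Submodule.Quotient.mk u
    have hmem : Quotient.out q - u ∈ L.1 := by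
      rw [← Submodule.Quotient.eq]; exact hmk L q
    obtain ⟨c, hc0, hc⟩ := pop_add_mem (hb0 L) u (hb2 L hmem)
    rw [add_sub_cancel] at hc
    have hne : qInner (pop (Quotient.out q) (base L)) φ ≠ 0 := by
      intro h
      rw [← qInner_conj, hc, qInner_smul_right] at h
      exact (mul_ne_zero hc0 hu) ((map_eq_zero _).1 h)
    have hpar := parallel_of_same L.2 (hunit L (Quotient.out q)) (le_refl _ : L.1 ≤ eigSub φ)
      (hsub L _).ge hne
    have hq : q ∉ (eigSub ψ).map L.1.mkQ := by
      rw [← horth]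
      rw [hpar, qInner_smul_right] at ho
      exact (mul_eq_zero.1 ho).resolve_left hne
    exact ⟨⟨L, q, hq⟩, Quot.sound ⟨_, hpar⟩⟩

lemma card_orth_sum {ψ : QState n} (hψ : IsStabilizerState n ψ) :
    stabQuotCard n (fun φ => qInner ψ φ = 0) + lagSum (symp n) (eigSub ψ) n 2 ⊥ =
      2 ^ n * lagSum (symp n) (eigSub ψ) n 1 ⊥ := by
  classical
  have : Fintype (Submodule (ZMod 2) (PV n)) := Fintype.ofFinite _
  have hM := stab_isLag hψ
  rw [card_orth hψ, Nat.card_sigma, lagSum_eq, lagSum_eq]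
  simp only [bot_le, and_true, one_pow, Finset.mul_sum, mul_one]
  rw [Finset.sum_subtype (p := fun L => IsLag (symp n) L) _ (by simp),
    Finset.sum_subtype (p := fun L => IsLag (symp n) L) _ (by simp), ← Finset.sum_add_distrib]
  exact Finset.sum_congr rfl (fun L _ => card_compl L.2 hM)

lemma prod_identity (n : ℕ) :
    3 * ∏ i ∈ Finset.range n, (1 + 2 * 2 ^ (i + 1)) =
      (1 + 2 ^ (n + 1)) * ∏ i ∈ Finset.range n, (1 + 1 * 2 ^ (i + 1)) := by
  induction n with
  | zero => simp
  | succ n ih =>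
    rw [Finset.prod_range_succ, Finset.prod_range_succ, ← mul_assoc, ih]
    ring

end Assembly

/-- The number of stabilizer states orthogonal to a given `n`-qubit stabilizer
state equals `N(n)(2^n - 1)/(3 · 2^n)` where `N(n) = 2^n ∏_{k<n}(2^{n-k}+1)` is
the total number of stabilizer states; in particular the fraction of
orthogonal states tends to `1/3` as `n → ∞`. -/
theorem card_orthogonal_stabilizer_states (n : ℕ) (ψ : QState n)
    (hψ : IsStabilizerState n ψ) :
    3 * 2 ^ n * stabQuotCard n (fun φ => qInner ψ φ = 0) =
      (2 ^ n * ∏ k ∈ Finset.range n, (2 ^ (n - k) + 1)) * (2 ^ n - 1) ∧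
    Filter.Tendsto (fun m : ℕ => ((2 : ℝ) ^ m - 1) / (3 * 2 ^ m))
      Filter.atTop (nhds (1 / 3)) := by
  constructor
  · have h := card_orth_sum hψ
    have hM := stab_isLag hψ
    have hf : ∀ r, lagSum (symp n) (eigSub ψ) n r ⊥ =
        ∏ i ∈ Finset.range n, (1 + r * 2 ^ (i + 1)) := fun r =>
      lagSum_formula (symp n) symp_symm symp_self symp_nondeg finrank_PV hM n ⊥ bot_le (by simp)
    rw [hf, hf] at h
    have hp := prod_identity n
    have hr : ∏ k ∈ Finset.range n, (2 ^ (n - k) + 1) =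
        ∏ i ∈ Finset.range n, (1 + 1 * 2 ^ (i + 1)) := by
      rw [← Finset.prod_range_reflect]
      apply Finset.prod_congr rfl
      intro k hk
      rw [Finset.mem_range] at hk
      have : n - (n - 1 - k) = k + 1 := by omega
      rw [this]; ring
    rw [hr]
    generalize ∏ i ∈ Finset.range n, (1 + 1 * 2 ^ (i + 1)) = A at *
    generalize ∏ i ∈ Finset.range n, (1 + 2 * 2 ^ (i + 1)) = C at *
    generalize stabQuotCard n (fun φ => qInner ψ φ = 0) = D at *
    have h1 : 1 ≤ 2 ^ n := Nat.one_le_two_pow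
    zify [h1] at h hp ⊢
    rw [pow_succ] at hp
    linear_combination (3 * 2 ^ n) * h - 2 ^ n * hp
  · have h1 : (fun m : ℕ => ((2 : ℝ) ^ m - 1) / (3 * 2 ^ m)) =
        fun m : ℕ => 1 / 3 - 1 / 3 * (1 / 2 : ℝ) ^ m := by
      funext m
      rw [div_pow, one_pow]
      field_simp
    rw [h1]
    have h2 : Filter.Tendsto (fun m : ℕ => (1 / 2 : ℝ) ^ m) Filter.atTop (nhds 0) :=
      tendsto_pow_atTop_nhds_zero_of_lt_one (by norm_num) (by norm_num)
    have h3 := (h2.const_mul (1 / 3 : ℝ)).const_sub (1 / 3 : ℝ)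
    rwa [mul_zero, sub_zero] at h3
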